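/- arXiv:1708.09584 — 4 statements merged into one kernel-verified Lean document; each statement's English description precedes it below -/
import Mathlib

section
/- The operators R_1, …, R_{r−1} on V^{⊗r} satisfy the (negated) Iwahori–Hecke relations: R_i² = (1−q)R_i + q·Id for 1 ≤ i ≤ r−1; R_iR_j = R_jR_i whenever |i−j| ≥ 2; and R_iR_{i+1}R_i = R_{i+1}R_iR_{i+1} for 1 ≤ i ≤ r−2. Consequently T_i ↦ R_i defines a representation Φ_{m,n}^{q,r} of the Iwahori–Hecke algebra H_r(q) of the symmetric group S_r on V^{⊗r} (the sign q-permutation representation). -/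
open Classical

noncomputable section

/-- The field `ℂ(t)` of rational functions over `ℂ`. -/
abbrev F : Type := RatFunc ℂ

/-- The indeterminate `t`. -/
def tt : F := RatFunc.X

/-- `q = t²`. -/
def qq : F := tt ^ 2

/-- The matrix of the sign `q`-permutation operator `R` on `V ⊗ V`:
`Rmat m N kl ij` is the coefficient of `v_{kl.1} ⊗ v_{kl.2}` in `R (v_{ij.1} ⊗ v_{ij.2})`.
Here the basis of `V` is indexed by `Fin N` (0-indexed), and the index `x` is even
(parity `0`) iff `(x : ℕ) < m`, odd otherwise. -/
def Rmat (m N : ℕ) : Matrix (Fin N × Fin N) (Fin N × Fin N) F := fun kl ij =>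
  if ij.1 < ij.2 then
    (if kl = ij then 1 - qq
     else if kl = (ij.2, ij.1) then (if (ij.1 : ℕ) < m ∨ (ij.2 : ℕ) < m then tt else -tt)
     else 0)
  else if ij.2 < ij.1 then
    (if kl = (ij.2, ij.1) then (if (ij.1 : ℕ) < m ∨ (ij.2 : ℕ) < m then tt else -tt) else 0)
  else
    (if kl = ij then (if (ij.1 : ℕ) < m then 1 else -qq) else 0)

/-- The matrix of the operator `R_j` on `V^{⊗r}` (`1 ≤ j ≤ r-1`, acting on the `j`-th and
`(j+1)`-st tensor factors, 1-indexed); for `j` outside this range it is the identity. -/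
def opR (m N r : ℕ) (j : ℕ) : Matrix (Fin r → Fin N) (Fin r → Fin N) F := fun f g =>
  if h : 1 ≤ j ∧ j < r then
    (if (∀ x : Fin r, (x : ℕ) + 1 ≠ j → (x : ℕ) ≠ j → f x = g x) then 1 else 0) *
      Rmat m N (f ⟨j - 1, by omega⟩, f ⟨j, by omega⟩) (g ⟨j - 1, by omega⟩, g ⟨j, by omega⟩)
  else if f = g then 1 else 0

/-- The matrix of the operator `R_1 R_2 ⋯ R_{a-1}` on `V^{⊗r}` (operators acting on the right:
the product denotes `v ↦ R_{a-1}(⋯ R_1(v))`, whose matrix is `M_{a-1} ⋯ M_1`). -/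
def Tarrow (m N r a : ℕ) : Matrix (Fin r → Fin N) (Fin r → Fin N) F :=
  (((List.range' 1 (a - 1)).map (opR m N r)).reverse).prod

/-- The word `γ_μ`: the concatenation over the parts `μ_i` of `μ` of the generator indices
`a_{i-1}+1, a_{i-1}+2, …, a_i - 1`. -/
def heckeWord : List ℕ → ℕ → List ℕ
  | [], _ => []
  | c :: cs, off => List.range' (off + 1) (c - 1) ++ heckeWord cs (off + c)

/-- The matrix of the standard operator `T_{γ_μ}` on `V^{⊗r}`. -/
def Tgamma (m N r : ℕ) (μ : List ℕ) : Matrix (Fin r → Fin N) (Fin r → Fin N) F :=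
  (((heckeWord μ 0).map (opR m N r)).reverse).prod


set_option synthInstance.maxHeartbeats 1000000

/-- The diagonal coefficient of the sign `q`-permutation operator at `v_a ⊗ v_b`. -/
def diagCoeff (m : ℕ) {N : ℕ} (a b : Fin N) : F :=
  if a < b then 1 - qq else if b < a then 0 else if (a : ℕ) < m then 1 else -qq

/-- The coefficient of `v_b ⊗ v_a` in the image of `v_a ⊗ v_b` for `a ≠ b`, and `0` for `a = b`. -/
def swapCoeff (m : ℕ) {N : ℕ} (a b : Fin N) : F :=
  if a = b then 0 else if (a : ℕ) < m ∨ (b : ℕ) < m then tt else -tt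

theorem Rmat_eq (m N : ℕ) (kl ij : Fin N × Fin N) :
    Rmat m N kl ij = diagCoeff m ij.1 ij.2 * (if kl = ij then 1 else 0) +
      swapCoeff m ij.1 ij.2 * (if kl = (ij.2, ij.1) then 1 else 0) := by
  obtain ⟨a, b⟩ := ij
  unfold Rmat diagCoeff swapCoeff
  rcases lt_trichotomy a b with h | rfl | h
  · by_cases hk : kl = (a, b) <;> simp [hk, h, h.ne]
  · simp
  · simp [h, h.not_gt, h.ne']

theorem eq_iff_agree_off_pair {ι α : Type*} (u v : ι) (f g : ι → α) :
    f = g ↔ (∀ x, x ≠ u → x ≠ v → f x = g x) ∧ (f u, f v) = (g u, g v) := by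
  refine ⟨by rintro rfl; simp, fun ⟨h, h'⟩ => funext fun x => ?_⟩
  rw [Prod.mk.injEq] at h'
  by_cases hu : x = u
  · rw [hu, h'.1]
  · by_cases hv : x = v
    · rw [hv, h'.2]
    · exact h x hu hv

theorem eq_comp_swap_iff {ι α : Type*} [DecidableEq ι] (u v : ι) (f g : ι → α) :
    f = g ∘ Equiv.swap u v ↔
      (∀ x, x ≠ u → x ≠ v → f x = g x) ∧ (f u, f v) = (g v, g u) := by
  rw [eq_iff_agree_off_pair u v]
  refine and_congr (forall_congr' fun x => forall_congr' fun hu => forall_congr' fun hv => ?_) ?_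
  · simp [Equiv.swap_apply_of_ne_of_ne hu hv]
  · simp

theorem opR_apply {m N r j : ℕ} (hj : 1 ≤ j) (hr : j < r) (u v : Fin r)
    (hu : (u : ℕ) = j - 1) (hv : (v : ℕ) = j) (f g : Fin r → Fin N) :
    opR m N r j f g = diagCoeff m (g u) (g v) * (if f = g then 1 else 0) +
      swapCoeff m (g u) (g v) * (if f = g ∘ Equiv.swap u v then 1 else 0) := by
  have hu' : (⟨j - 1, by omega⟩ : Fin r) = u := Fin.ext hu.symm
  have hv' : (⟨j, hr⟩ : Fin r) = v := Fin.ext hv.symm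
  have hoff : (∀ x : Fin r, (x : ℕ) + 1 ≠ j → (x : ℕ) ≠ j → f x = g x) ↔
      ∀ x : Fin r, x ≠ u → x ≠ v → f x = g x := by
    refine forall_congr' fun x => imp_congr ?_ (imp_congr ?_ Iff.rfl) <;>
      rw [Ne, Ne, Fin.ext_iff] <;> omega
  rw [opR, dif_pos ⟨hj, hr⟩, Rmat_eq, hu', hv']
  simp only [hoff, eq_comp_swap_iff u v f g, eq_iff_agree_off_pair u v f g]
  by_cases h : ∀ x : Fin r, x ≠ u → x ≠ v → f x = g x
  · simp only [if_pos h, and_iff_right h, one_mul]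
  · simp only [h, if_false, zero_mul, false_and, mul_zero, add_zero]

theorem vecMul_opR {m N r j : ℕ} (hj : 1 ≤ j) (hr : j < r) (u v : Fin r)
    (hu : (u : ℕ) = j - 1) (hv : (v : ℕ) = j) (x : (Fin r → Fin N) → F) (g : Fin r → Fin N) :
    Matrix.vecMul x (opR m N r j) g = diagCoeff m (g u) (g v) * x g +
      swapCoeff m (g u) (g v) * x (g ∘ Equiv.swap u v) := by
  simp only [Matrix.vecMul, dotProduct, opR_apply hj hr u v hu hv, mul_add, mul_ite, mul_one,
    mul_zero, Finset.sum_add_distrib, Finset.sum_ite_eq', Finset.mem_univ, if_true]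
  ring

section Coefficients

variable {m N : ℕ} {a b : Fin N}

theorem diagCoeff_of_lt (h : a < b) : diagCoeff m a b = 1 - qq := by
  simp [diagCoeff, h]

theorem diagCoeff_of_gt (h : b < a) : diagCoeff m a b = 0 := by
  simp [diagCoeff, h, h.not_gt]

theorem diagCoeff_self_sq (a : Fin N) :
    diagCoeff m a a ^ 2 = (1 - qq) * diagCoeff m a a + qq := by
  simp only [diagCoeff, lt_irrefl, if_false]
  split_ifs <;> ring

theorem swapCoeff_self (a : Fin N) : swapCoeff m a a = 0 := by
  simp [swapCoeff]

theorem swapCoeff_comm (a b : Fin N) : swapCoeff m a b = swapCoeff m b a := by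
  simp only [swapCoeff, eq_comm (a := a), or_comm (a := (a : ℕ) < m)]

theorem swapCoeff_sq (h : a ≠ b) : swapCoeff m a b ^ 2 = qq := by
  simp only [swapCoeff, h, if_false, qq]
  split_ifs <;> ring

end Coefficients

theorem coeff_quadratic (m : ℕ) {N : ℕ} (a b : Fin N) (X Y : F) :
    diagCoeff m a b * (diagCoeff m a b * X + swapCoeff m a b * Y) +
      swapCoeff m a b * (diagCoeff m b a * Y + swapCoeff m b a * X) =
    (1 - qq) * (diagCoeff m a b * X + swapCoeff m a b * Y) + qq * X := by
  rw [swapCoeff_comm b a]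
  rcases lt_trichotomy a b with h | rfl | h
  · rw [diagCoeff_of_lt h, diagCoeff_of_gt h]
    linear_combination X * swapCoeff_sq (m := m) h.ne
  · rw [swapCoeff_self]
    linear_combination X * diagCoeff_self_sq (m := m) a
  · rw [diagCoeff_of_lt h, diagCoeff_of_gt h]
    linear_combination X * swapCoeff_sq (m := m) h.ne'

/-- The action on functions of three indices by the operator in the first two tensor factors. -/
def actFst (m : ℕ) {N : ℕ} (y : Fin N → Fin N → Fin N → F) (a b c : Fin N) : F :=
  diagCoeff m a b * y a b c + swapCoeff m a b * y b a c

/-- The action on functions of three indices by the operator in the last two tensor factors. -/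
def actSnd (m : ℕ) {N : ℕ} (y : Fin N → Fin N → Fin N → F) (a b c : Fin N) : F :=
  diagCoeff m b c * y a b c + swapCoeff m b c * y a c b

theorem actFst_actSnd_braid (m : ℕ) {N : ℕ} (y : Fin N → Fin N → Fin N → F) (a b c : Fin N) :
    actFst m (actSnd m (actFst m y)) a b c = actSnd m (actFst m (actSnd m y)) a b c := by
  simp only [actFst, actSnd]
  rw [swapCoeff_comm b a, swapCoeff_comm c b]
  rcases eq_or_ne a b with rfl | hab
  · rcases eq_or_ne a c with rfl | hac
    · simp only [swapCoeff_self]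
    · have hd := diagCoeff_self_sq (m := m) a
      have hs := swapCoeff_sq (m := m) hac
      rcases hac.lt_or_gt with h | h <;>
        simp only [swapCoeff_self, diagCoeff_of_lt h, diagCoeff_of_gt h]
      · linear_combination (1 - qq) * y a a c * (hd - hs)
      · ring
  · have hp := swapCoeff_sq (m := m) hab
    rcases eq_or_ne b c with rfl | hbc
    · have hd := diagCoeff_self_sq (m := m) b
      rcases hab.lt_or_gt with h | h <;>
        simp only [swapCoeff_self, diagCoeff_of_lt h, diagCoeff_of_gt h]
      · linear_combination (1 - qq) * y a b b * (hp - hd)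
      · ring
    · have hs := swapCoeff_sq (m := m) hbc
      rcases eq_or_ne a c with rfl | hac
      · rw [swapCoeff_comm b a, swapCoeff_self]
        rcases hab.lt_or_gt with h | h <;>
          simp only [diagCoeff_of_lt h, diagCoeff_of_gt h] <;> ring
      · rcases hab.lt_or_gt with h | h <;> rcases hbc.lt_or_gt with h' | h' <;>
          rcases hac.lt_or_gt with h'' | h'' <;>
          first
          | (exfalso; order)
          | (simp only [diagCoeff_of_lt h, diagCoeff_of_gt h, diagCoeff_of_lt h',
              diagCoeff_of_gt h', diagCoeff_of_lt h'', diagCoeff_of_gt h'']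
             first | ring1 | linear_combination (1 - qq) * y a b c * (hp - hs))

/-- The tuple obtained from `g` by putting `a`, `b`, `c` in the positions `u`, `v`, `w`. -/
def updateTriple {ι α : Type*} [DecidableEq ι] (g : ι → α) (u v w : ι) (a b c : α) : ι → α :=
  Function.update (Function.update (Function.update g u a) v b) w c

section UpdateTriple

variable {ι α : Type*} [DecidableEq ι] {u v w : ι}

theorem updateTriple_apply_fst (huv : u ≠ v) (huw : u ≠ w) (g : ι → α) (a b c : α) :
    updateTriple g u v w a b c u = a := by
  simp [updateTriple, huv, huw]

theorem updateTriple_apply_snd (hvw : v ≠ w) (g : ι → α) (a b c : α) :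
    updateTriple g u v w a b c v = b := by
  simp [updateTriple, hvw]

theorem updateTriple_apply_trd (g : ι → α) (a b c : α) :
    updateTriple g u v w a b c w = c := by
  simp [updateTriple]

theorem updateTriple_self (g : ι → α) : updateTriple g u v w (g u) (g v) (g w) = g := by
  simp [updateTriple]

theorem updateTriple_comp_swap_fst (huv : u ≠ v) (huw : u ≠ w) (hvw : v ≠ w) (g : ι → α)
    (a b c : α) :
    updateTriple g u v w a b c ∘ Equiv.swap u v = updateTriple g u v w b a c := by
  funext x
  simp only [updateTriple, Function.comp_apply, Function.update_apply, Equiv.swap_apply_def]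
  grind

theorem updateTriple_comp_swap_snd (hvw : v ≠ w) (g : ι → α) (a b c : α) :
    updateTriple g u v w a b c ∘ Equiv.swap v w = updateTriple g u v w a c b := by
  funext x
  simp only [updateTriple, Function.comp_apply, Function.update_apply, Equiv.swap_apply_def]
  grind

end UpdateTriple

theorem matrix_eq_of_vecMul_eq {κ R : Type*} [Fintype κ] [NonAssocSemiring R]
    {A B : Matrix κ κ R} (h : ∀ x g, Matrix.vecMul x A g = Matrix.vecMul x B g) : A = B := by
  ext f g
  simpa using h (Pi.single f 1) g

theorem opR_mul_self {m N r i : ℕ} (hi : 1 ≤ i) (hr : i < r) :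
    opR m N r i * opR m N r i =
      (1 - qq) • opR m N r i + qq • (1 : Matrix (Fin r → Fin N) (Fin r → Fin N) F) := by
  refine matrix_eq_of_vecMul_eq fun x g => ?_
  have key := vecMul_opR (m := m) (N := N) hi hr ⟨i - 1, by omega⟩ ⟨i, hr⟩ rfl rfl
  rw [← Matrix.vecMul_vecMul, Matrix.vecMul_add, Matrix.vecMul_smul, Matrix.vecMul_smul,
    Matrix.vecMul_one]
  simp only [Pi.add_apply, Pi.smul_apply, smul_eq_mul, key, Function.comp_assoc,
    Function.comp_apply, Equiv.swap_apply_left, Equiv.swap_apply_right]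
  rw [← Equiv.coe_trans, Equiv.swap_swap, Equiv.coe_refl, Function.comp_id]
  exact coeff_quadratic m _ _ _ _

theorem opR_mul_comm {m N r i j : ℕ} (hi : 1 ≤ i) (hij : i + 2 ≤ j) (hr : j < r) :
    opR m N r i * opR m N r j = opR m N r j * opR m N r i := by
  refine matrix_eq_of_vecMul_eq fun x g => ?_
  have hir : i < r := by omega
  set u : Fin r := ⟨i - 1, by omega⟩ with hu
  set v : Fin r := ⟨i, hir⟩ with hv
  set u' : Fin r := ⟨j - 1, by omega⟩ with hu'
  set v' : Fin r := ⟨j, hr⟩ with hv'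
  have huu : u ≠ u' := by rw [Ne, Fin.ext_iff, hu, hu']; simp only; omega
  have huv : u ≠ v' := by rw [Ne, Fin.ext_iff, hu, hv']; simp only; omega
  have hvu : v ≠ u' := by rw [Ne, Fin.ext_iff, hv, hu']; simp only; omega
  have hvv : v ≠ v' := by rw [Ne, Fin.ext_iff, hv, hv']; simp only; omega
  have hcomm : ⇑(Equiv.swap u v) ∘ ⇑(Equiv.swap u' v') =
      ⇑(Equiv.swap u' v') ∘ ⇑(Equiv.swap u v) := by
    funext y
    simp only [Function.comp_apply, Equiv.swap_apply_def]
    grind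
  rw [← Matrix.vecMul_vecMul, ← Matrix.vecMul_vecMul]
  simp only [vecMul_opR hi hir u v rfl rfl, vecMul_opR (hi.trans (by omega)) hr u' v' rfl rfl,
    Function.comp_assoc, Function.comp_apply, hcomm,
    Equiv.swap_apply_of_ne_of_ne huu huv, Equiv.swap_apply_of_ne_of_ne hvu hvv,
    Equiv.swap_apply_of_ne_of_ne huu.symm hvu.symm, Equiv.swap_apply_of_ne_of_ne huv.symm hvv.symm]
  ring

theorem opR_braid {m N r i : ℕ} (hi : 1 ≤ i) (hr : i + 1 < r) :
    opR m N r i * opR m N r (i + 1) * opR m N r i =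
      opR m N r (i + 1) * opR m N r i * opR m N r (i + 1) := by
  refine matrix_eq_of_vecMul_eq fun x g => ?_
  have hir : i < r := by omega
  set u : Fin r := ⟨i - 1, by omega⟩ with hu
  set v : Fin r := ⟨i, hir⟩ with hv
  set w : Fin r := ⟨i + 1, hr⟩ with hw
  have huv : u ≠ v := by rw [Ne, Fin.ext_iff, hu, hv]; simp only; omega
  have huw : u ≠ w := by rw [Ne, Fin.ext_iff, hu, hw]; simp only; omega
  have hvw : v ≠ w := by rw [Ne, Fin.ext_iff, hv, hw]; simp only; omega
  have hfst (x : (Fin r → Fin N) → F) :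
      (fun a b c => Matrix.vecMul x (opR m N r i) (updateTriple g u v w a b c)) =
        actFst m (fun a b c => x (updateTriple g u v w a b c)) := by
    funext a b c
    rw [vecMul_opR hi hir u v rfl rfl, updateTriple_apply_fst huv huw,
      updateTriple_apply_snd hvw, updateTriple_comp_swap_fst huv huw hvw, actFst]
  have hsnd (x : (Fin r → Fin N) → F) :
      (fun a b c => Matrix.vecMul x (opR m N r (i + 1)) (updateTriple g u v w a b c)) =
        actSnd m (fun a b c => x (updateTriple g u v w a b c)) := by
    funext a b c
    rw [vecMul_opR (by omega) hr v w rfl rfl, updateTriple_apply_snd hvw,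
      updateTriple_apply_trd, updateTriple_comp_swap_snd hvw, actSnd]
  simp only [← Matrix.vecMul_vecMul]
  have h := actFst_actSnd_braid m (fun a b c => x (updateTriple g u v w a b c)) (g u) (g v) (g w)
  rw [← hfst, ← hsnd, ← hfst, ← hsnd, ← hfst, ← hsnd] at h
  simpa only [updateTriple_self] using h

/-- the operators `R_1, …, R_{r-1}` satisfy the (negated) Iwahori–Hecke
relations, so that `T_i ↦ R_i` defines the sign `q`-permutation representation of `H_r(q)`. -/
theorem hecke_relations (m n r : ℕ) (hmn : 0 < m + n) (hr : 1 ≤ r) :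
    (∀ i : ℕ, 1 ≤ i → i ≤ r - 1 →
      opR m (m + n) r i * opR m (m + n) r i =
        (1 - qq) • opR m (m + n) r i + qq • (1 : Matrix (Fin r → Fin (m + n)) (Fin r → Fin (m + n)) F)) ∧
    (∀ i j : ℕ, 1 ≤ i → i ≤ r - 1 → 1 ≤ j → j ≤ r - 1 → (i + 2 ≤ j ∨ j + 2 ≤ i) →
      opR m (m + n) r i * opR m (m + n) r j = opR m (m + n) r j * opR m (m + n) r i) ∧
    (∀ i : ℕ, 1 ≤ i → i ≤ r - 2 →
      opR m (m + n) r i * opR m (m + n) r (i + 1) * opR m (m + n) r i =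
        opR m (m + n) r (i + 1) * opR m (m + n) r i * opR m (m + n) r (i + 1)) := by
  refine ⟨fun i hi hir => opR_mul_self hi (by omega), fun i j hi hir hj hjr hij => ?_,
    fun i hi hir => opR_braid hi (by omega)⟩
  rcases hij with hij | hij
  · exact opR_mul_comm hi hij (by omega)
  · exact (opR_mul_comm hj hij (by omega)).symm

end
end

section
/- Let 2 ≤ a ≤ r, let i_1, …, i_r ∈ {1, …, m+n}, and set v = v_{i_1} ⊗ ⋯ ⊗ v_{i_r}. Expand (R_1R_2⋯R_{a−1})(v) in the basis of simple tensors v_{j_1} ⊗ ⋯ ⊗ v_{j_r}. Then the coefficient of v itself is 0 unless i_1 ≤ i_2 ≤ ⋯ ≤ i_a, and when i_1 ≤ i_2 ≤ ⋯ ≤ i_a this coefficient equals (−q)^{b−d′}(1−q)^{d−1}, where b = #{j : 1 ≤ j ≤ a and i_j > m}, d′ is the number of distinct values exceeding m among i_1, …, i_a, and d is the number of distinct values among i_1, …, i_a. -/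
open Classical

noncomputable section

/-- The diagonal entry of `Rmat` at `(i, j)`. -/
def Rdiag (m : ℕ) {N : ℕ} (i j : Fin N) : F :=
  if i < j then 1 - qq else if j < i then 0 else if (i : ℕ) < m then 1 else -qq

lemma Rmat_apply_of_fst_eq (m : ℕ) {N : ℕ} (i j k : Fin N) :
    Rmat m N (i, k) (i, j) = if k = j then Rdiag m i j else 0 := by
  rcases lt_trichotomy i j with h | rfl | h
  · simp [Rmat, Rdiag, h, h.ne]
  · simp [Rmat, Rdiag]
  · simp [Rmat, Rdiag, h, h.not_gt, h.ne']

lemma opR_succ_eq_zero (m N : ℕ) {r k : ℕ} (hk : k + 1 < r) {f g : Fin r → Fin N}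
    {x : Fin r} (hx : (x : ℕ) < k) (hfg : f x ≠ g x) : opR m N r (k + 1) f g = 0 := by
  have hne : ¬ ∀ x : Fin r, (x : ℕ) + 1 ≠ k + 1 → (x : ℕ) ≠ k + 1 → f x = g x :=
    fun h => hfg (h x (by omega) (by omega))
  rw [opR, dif_pos ⟨by omega, hk⟩, if_neg hne, zero_mul]

lemma opR_succ_apply (m N : ℕ) {r k : ℕ} (hk : k + 1 < r) {f g : Fin r → Fin N}
    (hfg : f ⟨k, by omega⟩ = g ⟨k, by omega⟩) :
    opR m N r (k + 1) f g =
      if f = g then Rdiag m (g ⟨k, by omega⟩) (g ⟨k + 1, hk⟩) else 0 := by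
  rw [opR, dif_pos ⟨by omega, hk⟩]
  simp only [Nat.add_sub_cancel, hfg, Rmat_apply_of_fst_eq]
  by_cases h : f = g
  · simp [h]
  · rw [if_neg h, mul_eq_zero, or_iff_not_imp_right]
    intro hlast
    refine if_neg fun hrest => h (funext fun x => ?_)
    by_cases h1 : (x : ℕ) = k
    · simpa only [← h1] using hfg
    by_cases h2 : (x : ℕ) = k + 1
    · have := (ite_ne_right_iff.mp hlast).1
      simpa only [← h2] using this
    exact hrest x (by omega) h2

lemma Tarrow_succ (m N r k : ℕ) :
    Tarrow m N r (k + 2) = opR m N r (k + 1) * Tarrow m N r (k + 1) := by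
  simp [Tarrow, List.range'_1_concat, Nat.add_comm]

/-- After the first `k` operators the first `k` tensor factors are final, so only the constant
path contributes to entries whose first `k` factors are those of the source. -/
lemma Tarrow_apply_of_eqOn (m : ℕ) {N r : ℕ} (w : ℕ → Fin N) (k : ℕ) (hk : k < r)
    (f : Fin r → Fin N) (hf : ∀ x : Fin r, (x : ℕ) < k → f x = w x) :
    Tarrow m N r (k + 1) f (fun x => w x) =
      if f = fun x : Fin r => w x then
        ∏ j ∈ Finset.range k, Rdiag m (w j) (w (j + 1)) else 0 := by
  induction k generalizing f with
  | zero => simp [Tarrow, Matrix.one_apply]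
  | succ k ih =>
    rw [Tarrow_succ, Matrix.mul_apply, Finset.sum_eq_single fun x : Fin r => w x]
    · rw [opR_succ_apply m N hk (hf _ (Nat.lt_succ_self k)),
        ih (by omega) _ fun _ _ => rfl, if_pos rfl, Finset.prod_range_succ]
      split_ifs <;> simp [mul_comm]
    · intro g _ hg
      by_cases hgw : ∀ x : Fin r, (x : ℕ) < k → g x = w x
      · rw [ih (by omega) g hgw, if_neg hg, mul_zero]
      · push Not at hgw
        obtain ⟨x, hx, hne⟩ := hgw
        rw [opR_succ_eq_zero m N hk hx, zero_mul]
        rw [hf x (by omega)]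
        exact hne.symm
    · simp

lemma Tarrow_diag (m : ℕ) {N r : ℕ} (w : ℕ → Fin N) (k : ℕ) (hk : k < r) :
    Tarrow m N r (k + 1) (fun x => w x) (fun x => w x) =
      ∏ j ∈ Finset.range k, Rdiag m (w j) (w (j + 1)) := by
  rw [Tarrow_apply_of_eqOn m w k hk _ fun _ _ => rfl, if_pos rfl]

lemma prod_Rdiag_of_monotone (m : ℕ) {N : ℕ} (w : ℕ → Fin N) (k : ℕ)
    (hw : ∀ j < k, w j ≤ w (j + 1)) :
    ∏ j ∈ Finset.range k, Rdiag m (w j) (w (j + 1)) =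
      (-qq) ^ (((Finset.range (k + 1)).filter fun j => m ≤ (w j : ℕ)).card
          - (((Finset.range (k + 1)).image w).filter fun v : Fin N => m ≤ (v : ℕ)).card) *
        (1 - qq) ^ (((Finset.range (k + 1)).image w).card - 1) := by
  induction k with
  | zero =>
    by_cases h : m ≤ (w 0 : ℕ) <;> simp [Finset.filter_singleton, h]
  | succ k ih =>
    have hpos : 0 < ((Finset.range (k + 1)).image w).card :=
      Finset.card_pos.mpr ⟨w 0, Finset.mem_image_of_mem w (by simp)⟩
    have hle : (((Finset.range (k + 1)).image w).filter fun v : Fin N => m ≤ (v : ℕ)).card ≤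
        ((Finset.range (k + 1)).filter fun j => m ≤ (w j : ℕ)).card := by
      rw [Finset.filter_image]
      exact Finset.card_image_le
    have hmax : ∀ i ≤ k, w i ≤ w k := fun i hi =>
      Nat.decreasingInduction' (P := fun i => w i ≤ w k)
        (fun j hj _ h => (hw j (by omega)).trans h) hi le_rfl
    have hstep := hw k (Nat.lt_succ_self k)
    rw [Finset.prod_range_succ, ih fun j hj => hw j (by omega),
      Finset.range_add_one (n := k + 1), Finset.image_insert, Finset.filter_insert,
      Finset.filter_insert]
    have hnew : k + 1 ∉ (Finset.range (k + 1)).filter fun j => m ≤ (w j : ℕ) := by simp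
    rcases hstep.lt_or_eq with h | h
    · have hnot : w (k + 1) ∉ (Finset.range (k + 1)).image w := by
        simp only [Finset.mem_image, Finset.mem_range, not_exists, not_and]
        exact fun i hi he => (hmax i (by omega)).not_gt (he ▸ h)
      have hnot' : w (k + 1) ∉ ((Finset.range (k + 1)).image w).filter fun v : Fin N => m ≤ (v : ℕ) :=
        fun h => hnot (Finset.mem_filter.mp h).1
      rw [Finset.card_insert_of_notMem hnot, Rdiag, if_pos h, mul_assoc, ← pow_succ,
        Nat.sub_add_cancel hpos, Nat.add_sub_cancel]
      split_ifs
      · rw [Finset.card_insert_of_notMem hnew, Finset.card_insert_of_notMem hnot',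
          Nat.add_sub_add_right]
      · rfl
    · have hmem : w (k + 1) ∈ (Finset.range (k + 1)).image w :=
        h ▸ Finset.mem_image_of_mem w (by simp)
      rw [Finset.insert_eq_of_mem hmem, Rdiag, ← h, if_neg (lt_irrefl _), if_neg (lt_irrefl _)]
      by_cases hm : m ≤ (w k : ℕ)
      · have hmem' : w k ∈ ((Finset.range (k + 1)).image w).filter fun v : Fin N => m ≤ (v : ℕ) :=
          Finset.mem_filter.mpr ⟨h ▸ hmem, hm⟩
        rw [if_neg hm.not_gt, if_pos hm, if_pos hm, Finset.card_insert_of_notMem hnew,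
          Finset.insert_eq_of_mem hmem', Nat.sub_add_comm hle, pow_succ]
        ring
      · rw [if_pos (not_le.mp hm), if_neg hm, if_neg hm, mul_one]

lemma card_filter_fin_lt {r a : ℕ} (har : a ≤ r) (p : ℕ → Prop) [DecidablePred p] :
    (Finset.univ.filter fun x : Fin r => (x : ℕ) < a ∧ p x).card =
      ((Finset.range a).filter p).card := by
  rw [← Finset.card_map Fin.valEmbedding]
  congr 1
  ext j
  simp only [Finset.mem_map, Finset.mem_filter, Finset.mem_univ, true_and, Finset.mem_range,
    Fin.valEmbedding_apply]
  exact ⟨by rintro ⟨x, hx, rfl⟩; exact hx, fun h => ⟨⟨j, by omega⟩, h, rfl⟩⟩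

lemma image_filter_fin_lt {r a N : ℕ} (har : a ≤ r) (w : ℕ → Fin N) :
    ((Finset.univ.filter fun x : Fin r => (x : ℕ) < a).image fun x : Fin r => w x) =
      (Finset.range a).image w := by
  ext v
  simp only [Finset.mem_image, Finset.mem_filter, Finset.mem_univ, true_and, Finset.mem_range]
  exact ⟨by rintro ⟨x, hx, rfl⟩; exact ⟨x, hx, rfl⟩,
    by rintro ⟨j, hj, rfl⟩; exact ⟨⟨j, by omega⟩, hj, rfl⟩⟩

/-- Filtering the image of `s : Finset (Fin N)` in `ℕ`, where the coercion of a finset along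
`Fin N → ℕ` is expressed through the monad structure on `Finset`. -/
lemma card_filter_coe {N : ℕ} (s : Finset (Fin N)) (p : ℕ → Prop) [DecidablePred p] :
    ((do let v ← s; pure (v : ℕ) : Finset ℕ).filter p).card =
      (s.filter fun v : Fin N => p v).card := by
  rw [← Finset.card_map Fin.valEmbedding]
  congr 1
  ext j
  simp only [Finset.bind_def, Finset.pure_def, Finset.mem_filter, Finset.mem_sup,
    Finset.mem_singleton, Finset.mem_map, Fin.valEmbedding_apply]
  exact ⟨by rintro ⟨⟨v, hv, rfl⟩, h⟩; exact ⟨v, ⟨hv, h⟩, rfl⟩,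
    by rintro ⟨v, ⟨hv, h⟩, rfl⟩; exact ⟨⟨v, hv, rfl⟩, h⟩⟩

/-- the diagonal coefficient of `v = v_{i_1} ⊗ ⋯ ⊗ v_{i_r}` in
`(R_1 R_2 ⋯ R_{a-1})(v)`: it vanishes unless `i_1 ≤ ⋯ ≤ i_a`, in which case it equals
`(-q)^{b - d'} (1 - q)^{d - 1}`. -/
theorem diagonal_coefficient (m n r a : ℕ) (hmn : 0 < m + n) (ha : 2 ≤ a) (har : a ≤ r)
    (idx : Fin r → Fin (m + n)) :
    (¬ (∀ x : Fin r, (h : (x : ℕ) + 1 < a) → idx x ≤ idx ⟨(x : ℕ) + 1, by omega⟩) →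
      Tarrow m (m + n) r a idx idx = 0) ∧
    ((∀ x : Fin r, (h : (x : ℕ) + 1 < a) → idx x ≤ idx ⟨(x : ℕ) + 1, by omega⟩) →
      Tarrow m (m + n) r a idx idx =
        (-qq) ^ ((Finset.univ.filter fun x : Fin r => (x : ℕ) < a ∧ m ≤ (idx x : ℕ)).card
            - (((Finset.univ.filter fun x : Fin r => (x : ℕ) < a).image idx).filter
                (fun v => m ≤ (v : ℕ))).card) *
          (1 - qq) ^ ((((Finset.univ.filter fun x : Fin r => (x : ℕ) < a).image idx).card) - 1)) := by
  obtain ⟨w, rfl⟩ : ∃ w : ℕ → Fin (m + n), idx = fun x : Fin r => w x :=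
    ⟨fun j => if h : j < r then idx ⟨j, h⟩ else idx ⟨0, by omega⟩, by ext x; simp⟩
  obtain ⟨k, rfl⟩ : ∃ k, a = k + 1 := ⟨a - 1, by omega⟩
  rw [Tarrow_diag m w k har]
  constructor
  · intro h
    push Not at h
    obtain ⟨x, hx, hlt⟩ := h
    refine Finset.prod_eq_zero (i := (x : ℕ)) (by simpa using hx) ?_
    rw [Rdiag, if_neg hlt.not_gt, if_pos hlt]
  · intro h
    rw [prod_Rdiag_of_monotone m w k fun j hj => h ⟨j, by omega⟩ (by simpa using hj),
      card_filter_coe, image_filter_fin_lt har w, card_filter_fin_lt har fun j => m ≤ (w j : ℕ)]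

end
end

section
/- (The n = 0 case: Jimbo's q-permutation representation) Suppose n = 0, so that V has basis v_1, …, v_m with all basis vectors even. Then for every a ≥ 1, the trace of R_1R_2⋯R_{a−1} on V^{⊗a} equals Σ_{α ⊨ a} C(m, ℓ(α)) · (1−q)^{ℓ(α)−1}, where the sum is over all compositions α of a and C(m, k) is the binomial coefficient. -/
open Classical

noncomputable section

theorem card_boundaries_compositionAsSetEquiv_symm (n : ℕ) (S : Finset (Fin n)) :
    ((compositionAsSetEquiv (n + 1)).symm S).boundaries.card = S.card + 2 := by
  have h : ((compositionAsSetEquiv (n + 1)).symm S).boundaries =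
      insert 0 (insert (Fin.last (n + 1))
        (S.map (Fin.castSuccEmb.trans (Fin.succEmb (n + 1))))) := by
    ext i
    simp only [compositionAsSetEquiv, Equiv.coe_fn_symm_mk, Set.mem_toFinset, Set.mem_ofPred_eq,
      Finset.mem_insert, Finset.mem_map]
    refine or_congr_right (or_congr_right ⟨?_, ?_⟩)
    · rintro ⟨j, hj, h⟩
      exact ⟨j, hj, Fin.ext (by simpa using h.symm)⟩
    · rintro ⟨j, hj, rfl⟩
      exact ⟨j, hj, by simp⟩
  rw [h, Finset.card_insert_of_notMem, Finset.card_insert_of_notMem, Finset.card_map]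
  · simp only [Finset.mem_map, not_exists, not_and]
    intro j _ h
    have := congrArg Fin.val h
    have := j.isLt
    simp at *
  · simp only [Finset.mem_insert, Finset.mem_map, not_or, not_exists, not_and]
    refine ⟨(Fin.last_pos).ne, fun j _ h => ?_⟩
    have := congrArg Fin.val h
    simp at this

theorem sum_composition_length {A : Type*} [AddCommMonoid A] (n : ℕ) (f : ℕ → A) :
    ∑ α : Composition (n + 1), f α.length =
      ∑ k ∈ Finset.range (n + 1), n.choose k • f (k + 1) := by
  have h : ∑ α : Composition (n + 1), f α.length = ∑ S : Finset (Fin n), f (S.card + 1) := by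
    refine Fintype.sum_equiv ((compositionEquiv (n + 1)).trans (compositionAsSetEquiv (n + 1)))
      _ _ fun α => ?_
    have h₁ := card_boundaries_compositionAsSetEquiv_symm n
      (compositionAsSetEquiv (n + 1) (compositionEquiv (n + 1) α))
    rw [Equiv.symm_apply_apply, CompositionAsSet.card_boundaries_eq_succ_length] at h₁
    have h₂ : (compositionEquiv (n + 1) α).length = α.length := α.toCompositionAsSet_length
    congr 1
    simp only [Equiv.trans_apply]
    omega
  rw [h, ← Finset.powerset_univ, Finset.sum_powerset_apply_card (fun k => f (k + 1))]
  simp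

theorem sum_choose_rev (m k : ℕ) :
    ∑ z : Fin m, (m - 1 - (z : ℕ)).choose k = m.choose (k + 1) := by
  induction m with
  | zero => simp
  | succ m ih =>
    rw [Fin.sum_univ_succ, Nat.choose_succ_succ, ← ih]
    congr 1
    refine Finset.sum_congr rfl fun z _ => ?_
    congr 1
    simp only [Fin.val_succ]
    omega

theorem sum_choose_rev_of_lt (m k : ℕ) (y : Fin m) :
    ∑ z : Fin m, (if y < z then (m - 1 - (z : ℕ)).choose k else 0) =
      (m - 1 - (y : ℕ)).choose (k + 1) := by
  induction m with
  | zero => exact y.elim0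
  | succ m ih =>
    have hs (z : Fin m) : m + 1 - 1 - ((z.succ : Fin (m + 1)) : ℕ) = m - 1 - (z : ℕ) := by
      simp only [Fin.val_succ]; omega
    rw [Fin.sum_univ_succ]
    simp only [hs]
    cases y using Fin.cases with
    | zero => simpa using sum_choose_rev m k
    | succ y =>
      rw [hs]
      simpa using ih y

/-- The weight of two consecutive letters in the diagonal entries of `R_1 ⋯ R_{a-1}`. -/
def stepWeight {A : Type*} [CommRing A] {m : ℕ} (x : A) (y z : Fin m) : A :=
  (if z = y then 1 else 0) + x * (if y < z then 1 else 0)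

theorem sum_prod_stepWeight_cons {A : Type*} [CommRing A] {m : ℕ} (x : A) (n : ℕ) (y : Fin m) :
    ∑ g : Fin n → Fin m, ∏ j : Fin n,
        stepWeight x ((Fin.cons y g : Fin (n + 1) → Fin m) j.castSucc)
          ((Fin.cons y g : Fin (n + 1) → Fin m) j.succ) =
      ∑ k ∈ Finset.range (n + 1), (n.choose k : A) * ((m - 1 - (y : ℕ)).choose k : A) * x ^ k := by
  induction n generalizing y with
  | zero => simp
  | succ n ih =>
    have h : ∑ g : Fin (n + 1) → Fin m, ∏ j : Fin (n + 1),
        stepWeight x ((Fin.cons y g : Fin (n + 2) → Fin m) j.castSucc)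
          ((Fin.cons y g : Fin (n + 2) → Fin m) j.succ) =
        ∑ z : Fin m, stepWeight x y z * ∑ k ∈ Finset.range (n + 1),
          (n.choose k : A) * ((m - 1 - (z : ℕ)).choose k : A) * x ^ k := by
      rw [← (Fin.consEquiv fun _ => Fin m).sum_comp, Fintype.sum_prod_type]
      refine Finset.sum_congr rfl fun z _ => ?_
      rw [← ih z, Finset.mul_sum]
      refine Finset.sum_congr rfl fun g _ => ?_
      rw [Fin.prod_univ_succ]
      simp [Fin.consEquiv]
    have hstep (k : ℕ) : ∑ z : Fin m, (if y < z then 1 else 0) * ((m - 1 - (z : ℕ)).choose k : A) =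
        ((m - 1 - (y : ℕ)).choose (k + 1) : A) := by
      rw [← sum_choose_rev_of_lt m k y]
      push_cast
      refine Finset.sum_congr rfl fun z _ => ?_
      split_ifs <;> simp
    have hsum : ∑ z : Fin m, (if y < z then (1 : A) else 0) * ∑ k ∈ Finset.range (n + 1),
          (n.choose k : A) * ((m - 1 - (z : ℕ)).choose k : A) * x ^ k =
        ∑ k ∈ Finset.range (n + 1),
          (n.choose k : A) * ((m - 1 - (y : ℕ)).choose (k + 1) : A) * x ^ k := by
      simp only [Finset.mul_sum]
      rw [Finset.sum_comm]
      refine Finset.sum_congr rfl fun k _ => ?_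
      rw [← hstep k, Finset.mul_sum, Finset.sum_mul]
      exact Finset.sum_congr rfl fun z _ => by ring
    rw [h]
    simp only [stepWeight, add_mul, Finset.sum_add_distrib, mul_assoc x, ← Finset.mul_sum, hsum]
    rw [Finset.sum_range_succ' _ (n + 1)]
    have hsplit (k : ℕ) : ((n + 1).choose (k + 1) : A) * ((m - 1 - (y : ℕ)).choose (k + 1) : A) *
        x ^ (k + 1) = x * ((n.choose k : A) * ((m - 1 - (y : ℕ)).choose (k + 1) : A) * x ^ k) +
          (n.choose (k + 1) : A) * ((m - 1 - (y : ℕ)).choose (k + 1) : A) * x ^ (k + 1) := by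
      rw [Nat.choose_succ_succ]
      push_cast
      ring
    simp only [hsplit, Finset.sum_add_distrib, ← Finset.mul_sum]
    simp only [ite_mul, one_mul, zero_mul, Finset.sum_ite_eq', Finset.mem_univ, if_true]
    rw [Finset.sum_range_succ (fun k => (n.choose (k + 1) : A) * _ * x ^ (k + 1)) n,
      Finset.sum_range_succ' (fun k => (n.choose k : A) * ((m - 1 - (y : ℕ)).choose k : A) * x ^ k)]
    simp only [Nat.choose_succ_self, Nat.choose_zero_right]
    ring

theorem sum_prod_stepWeight {A : Type*} [CommRing A] (m n : ℕ) (x : A) :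
    ∑ g : Fin (n + 1) → Fin m, ∏ j : Fin n, stepWeight x (g j.castSucc) (g j.succ) =
      ∑ k ∈ Finset.range (n + 1), (n.choose k : A) * (m.choose (k + 1) : A) * x ^ k := by
  rw [← (Fin.consEquiv fun _ => Fin m).sum_comp, Fintype.sum_prod_type]
  simp only [Fin.consEquiv, Equiv.coe_fn_mk, sum_prod_stepWeight_cons]
  rw [Finset.sum_comm]
  refine Finset.sum_congr rfl fun k _ => ?_
  rw [← sum_choose_rev m k]
  push_cast
  rw [Finset.mul_sum, Finset.sum_mul]

theorem Rmat_apply_same_left (m : ℕ) (x y z : Fin m) :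
    Rmat m m (x, z) (x, y) = if z = y then stepWeight (1 - qq) x y else 0 := by
  unfold Rmat stepWeight
  rcases lt_trichotomy x y with h | rfl | h
  · simp [h, h.ne, h.ne']
  · simp
  · simp [h, h.not_gt, h.ne, h.ne']

theorem opR_apply_of_eq (m n k : ℕ) (hk : k < n) (f g : Fin (n + 1) → Fin m)
    (hfg : ∀ i : Fin (n + 1), (i : ℕ) < k + 1 → f i = g i) :
    opR m m (n + 1) (k + 1) f g =
      if f = g then stepWeight (1 - qq) (g ⟨k, by omega⟩) (g ⟨k + 1, by omega⟩) else 0 := by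
  unfold opR
  rw [dif_pos ⟨by omega, by omega⟩]
  have hk' : f ⟨k + 1 - 1, by omega⟩ = g ⟨k + 1 - 1, by omega⟩ := hfg _ (by simp)
  rw [hk', Rmat_apply_same_left]
  by_cases h : f = g
  · simp [h]
  · rw [if_neg h]
    by_cases h₁ : f ⟨k + 1, by omega⟩ = g ⟨k + 1, by omega⟩
    · rw [if_neg, zero_mul]
      intro h₂
      refine h (funext fun i => ?_)
      by_cases hi : (i : ℕ) < k + 1
      · exact hfg i hi
      · by_cases hi' : (i : ℕ) = k + 1
        · rwa [show i = ⟨k + 1, by omega⟩ from Fin.ext hi']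
        · exact h₂ i (by omega) hi'
    · rw [if_neg h₁, mul_zero]

theorem opR_apply_eq_zero (m n k : ℕ) (hk : k < n) (f g : Fin (n + 1) → Fin m)
    (i : Fin (n + 1)) (hi : (i : ℕ) < k) (hfg : f i ≠ g i) :
    opR m m (n + 1) (k + 1) f g = 0 := by
  unfold opR
  rw [dif_pos ⟨by omega, by omega⟩, if_neg, zero_mul]
  exact fun h => hfg (h i (by omega) (by omega))

theorem Tarrow_apply_of_eq (m n k : ℕ) (hk : k ≤ n) (f g : Fin (n + 1) → Fin m)
    (hfg : ∀ i : Fin (n + 1), (i : ℕ) < k → f i = g i) :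
    Tarrow m m (n + 1) (k + 1) f g =
      if f = g then ∏ j : Fin k, stepWeight (1 - qq) (g ⟨j, by omega⟩) (g ⟨j + 1, by omega⟩)
      else 0 := by
  induction k generalizing f with
  | zero => simp [Tarrow, Matrix.one_apply]
  | succ k ih =>
    have hT : Tarrow m m (n + 1) (k + 1 + 1) =
        opR m m (n + 1) (k + 1) * Tarrow m m (n + 1) (k + 1) := by
      simp [Tarrow, List.range'_concat, add_comm]
    rw [hT, Matrix.mul_apply, Finset.sum_eq_single g]
    · rw [ih (by omega) g fun _ _ => rfl, opR_apply_of_eq m n k (by omega) f g hfg]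
      by_cases h : f = g
      · simp [h, Fin.prod_univ_castSucc, mul_comm]
      · simp [h]
    · intro h _ hne
      by_cases hfh : ∀ i : Fin (n + 1), (i : ℕ) < k → f i = h i
      · rw [ih (by omega) h fun i hi => (hfh i hi).symm.trans (hfg i (by omega)), if_neg hne,
          mul_zero]
      · push Not at hfh
        obtain ⟨i, hi, hne'⟩ := hfh
        rw [opR_apply_eq_zero m n k (by omega) f h i hi hne', zero_mul]
    · simp

/-- the `n = 0` case: Jimbo's `q`-permutation representation: for `n = 0`
the trace of `R_1 R_2 ⋯ R_{a-1}` on `V^{⊗a}` equals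
`∑_{α ⊨ a} C(m, ℓ(α)) (1-q)^{ℓ(α)-1}`, the sum over all compositions `α` of `a`. -/
theorem trace_Tarrow_n_zero (m a : ℕ) (hm : 1 ≤ m) (ha : 1 ≤ a) :
    Matrix.trace (Tarrow m m a a) =
      ∑ α : Composition a, (Nat.choose m α.length : F) * (1 - qq) ^ (α.length - 1) := by
  obtain ⟨n, rfl⟩ : ∃ n, a = n + 1 := ⟨a - 1, by omega⟩
  rw [sum_composition_length n fun l => (Nat.choose m l : F) * (1 - qq) ^ (l - 1)]
  simp only [Matrix.trace, Matrix.diag_apply]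
  calc ∑ g, Tarrow m m (n + 1) (n + 1) g g
      = ∑ g : Fin (n + 1) → Fin m, ∏ j : Fin n,
          stepWeight (1 - qq) (g j.castSucc) (g j.succ) := by
        refine Finset.sum_congr rfl fun g _ => ?_
        rw [Tarrow_apply_of_eq m n n le_rfl g g fun _ _ => rfl, if_pos rfl]
        rfl
    _ = _ := by
        rw [sum_prod_stepWeight]
        simp [nsmul_eq_mul, mul_assoc]

end
end

section
/- (The Θ^{2,1} evaluation) For all integers m, n ≥ 0 and a ≥ 1, the following identity holds in ℂ(q): Σ_{(α;β)⊨a, ℓ(α)=2, ℓ(β)=1} C(m,2) · C(n,1) · (−q)^{|β|−1} · (1−q)² = n · C(m,2) · ( (a−1)(1+q) − (1 − (−q)^{a−1}) ) · (1−q)²/(1+q)², where the sum is over all bicompositions (α;β) of a with exactly two parts in α and one part in β. -/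
open Classical

noncomputable section

/-- The indeterminate `q`. -/
def qv : F := RatFunc.X

theorem Composition.card_filter_length_eq_one (n : ℕ) :
    (Finset.univ.filter fun c : Composition n => c.length = 1).card = if n = 0 then 0 else 1 := by
  split_ifs with h
  · subst h
    rw [Finset.card_eq_zero, Finset.filter_eq_empty_iff]
    intro c _ hc
    have := c.length_le
    omega
  · rw [Finset.card_eq_one]
    refine ⟨Composition.single n (Nat.pos_of_ne_zero h), ?_⟩
    ext c
    simp [Composition.eq_single_iff_length]

theorem Composition.card_filter_length_eq_two (n : ℕ) :
    (Finset.univ.filter fun c : Composition n => c.length = 2).card = n - 1 := by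
  symm
  rw [← Finset.card_range (n - 1)]
  refine Finset.card_bij
    (fun i hi => ⟨[i + 1, n - 1 - i], ?_, ?_⟩) ?_ ?_ ?_
  · have := Finset.mem_range.mp hi
    simp only [List.mem_cons, List.not_mem_nil, or_false]
    omega
  · have := Finset.mem_range.mp hi
    simp only [List.sum_cons, List.sum_nil]
    omega
  · intro i hi
    simp [Composition.length]
  · intro i hi j hj h
    simpa using (congrArg (fun c => c.blocks.head?) h)
  · intro c hc
    obtain ⟨x, y, hxy⟩ := List.length_eq_two.mp (Finset.mem_filter.mp hc).2
    have hx : 0 < x := c.blocks_pos (by simp [hxy])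
    have hy : 0 < y := c.blocks_pos (by simp [hxy])
    have hs : x + y = n := by simpa [hxy] using c.blocks_sum
    refine ⟨x - 1, Finset.mem_range.mpr (by omega), ?_⟩
    ext1
    simp only [hxy, List.cons.injEq, and_true]
    omega

theorem one_add_qv_ne_zero : 1 + qv ≠ 0 := by
  intro h
  have hX : algebraMap (Polynomial ℂ) (RatFunc ℂ) (Polynomial.X + Polynomial.C 1) = 0 := by
    simpa [qv, add_comm] using h
  rw [map_eq_zero_iff _ (RatFunc.algebraMap_injective ℂ)] at hX
  exact Polynomial.X_add_C_ne_zero 1 hX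

/-- The closed form of `∑ k, k x ^ (N - 1 - k)`, cleared of denominators. -/
theorem sum_range_mul_pow_sub {R : Type*} [CommRing R] (x : R) (N : ℕ) :
    (∑ k ∈ Finset.range N, (k : R) * x ^ (N - 1 - k)) * (1 - x) ^ 2 =
      N * (1 - x) - (1 - x ^ N) := by
  induction N with
  | zero => simp
  | succ N ih =>
    have h : ∑ k ∈ Finset.range N, (k : R) * x ^ (N + 1 - 1 - k) =
        x * ∑ k ∈ Finset.range N, (k : R) * x ^ (N - 1 - k) := by
      rw [Finset.mul_sum]
      refine Finset.sum_congr rfl fun k hk => ?_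
      have := Finset.mem_range.mp hk
      rw [show N + 1 - 1 - k = (N - 1 - k) + 1 by omega]
      ring
    rw [Finset.sum_range_succ, h, add_mul, mul_assoc, ih]
    simp only [Nat.add_sub_cancel, Nat.sub_self, pow_zero]
    push_cast
    ring

/-- the `Θ^{2,1}` evaluation: summing
`C(m,2) C(n,1) (-q)^{|β|-1} (1-q)²` over all bicompositions `(α;β) ⊨ a` with `ℓ(α) = 2`,
`ℓ(β) = 1` gives `n C(m,2) ((a-1)(1+q) - (1 - (-q)^{a-1})) (1-q)²/(1+q)²`.
(A bicomposition of `a` is encoded as `k ≤ a` together with a composition `α` of `k` and a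
composition `β` of `a - k`.) -/
theorem theta_two_one (m n a : ℕ) (ha : 1 ≤ a) :
    (∑ k ∈ Finset.range (a + 1), ∑ α : Composition k, ∑ β : Composition (a - k),
      if α.length = 2 ∧ β.length = 1 then
        (Nat.choose m 2 : F) * (Nat.choose n 1 : F) * (-qv) ^ (β.blocks.sum - 1) * (1 - qv) ^ 2
      else 0) =
      (n : F) * (Nat.choose m 2 : F) *
        (((a : F) - 1) * (1 + qv) - (1 - (-qv) ^ (a - 1))) * (1 - qv) ^ 2 / (1 + qv) ^ 2 := by
  obtain ⟨N, rfl⟩ : ∃ N, a = N + 1 := ⟨a - 1, by omega⟩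
  have inner (k : ℕ) : (∑ α : Composition k, ∑ β : Composition (N + 1 - k),
      if α.length = 2 ∧ β.length = 1 then
        (Nat.choose m 2 : F) * (Nat.choose n 1 : F) * (-qv) ^ (β.blocks.sum - 1) * (1 - qv) ^ 2
      else 0) = ((k - 1 : ℕ) : F) * ((if N + 1 - k = 0 then 0 else 1 : ℕ) : F) *
        ((Nat.choose m 2 : F) * n * (-qv) ^ (N + 1 - k - 1) * (1 - qv) ^ 2) := by
    simp_rw [Composition.blocks_sum, Nat.choose_one_right, ite_and, Finset.sum_ite_irrel,
      Finset.sum_const_zero, ← Finset.sum_filter, Finset.sum_const,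
      Composition.card_filter_length_eq_one, Composition.card_filter_length_eq_two,
      nsmul_eq_mul, mul_assoc]
  have key := sum_range_mul_pow_sub (-qv) N
  rw [sub_neg_eq_add] at key
  rw [eq_div_iff (pow_ne_zero 2 one_add_qv_ne_zero), Finset.sum_congr rfl fun k _ => inner k,
    Finset.sum_range_succ, Finset.sum_range_succ']
  have hsum : ∑ k ∈ Finset.range N, ((k + 1 - 1 : ℕ) : F) *
        ((if N + 1 - (k + 1) = 0 then 0 else 1 : ℕ) : F) *
        ((Nat.choose m 2 : F) * n * (-qv) ^ (N + 1 - (k + 1) - 1) * (1 - qv) ^ 2) =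
      (Nat.choose m 2 : F) * n * (1 - qv) ^ 2 *
        ∑ k ∈ Finset.range N, (k : F) * (-qv) ^ (N - 1 - k) := by
    rw [Finset.mul_sum]
    refine Finset.sum_congr rfl fun k hk => ?_
    have := Finset.mem_range.mp hk
    rw [if_neg (by omega), show N + 1 - (k + 1) - 1 = N - 1 - k by omega, Nat.add_sub_cancel]
    push_cast
    ring
  rw [hsum, Nat.sub_self, if_pos rfl, Nat.zero_sub, Nat.add_sub_cancel]
  push_cast
  linear_combination (Nat.choose m 2 : F) * n * (1 - qv) ^ 2 * key

end
end
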